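/- arXiv:1106.0131 — 3 statements merged into one kernel-verified Lean document; each statement's English description precedes it below -/
import Mathlib

section
/- The spectrum of H is symmetric with respect to zero: for every complex number z, z belongs to the spectrum of H if and only if −z belongs to the spectrum of H. -/
open ContinuousLinearMap

/-- An element that anticommutes with an involution has spectrum symmetric about zero. -/
theorem neg_mem_spectrum_iff_of_anticommute {R A : Type*} [CommRing R] [Ring A] [Algebra R A]
    {u a : A} (hu : u * u = 1) (hua : u * a = -(a * u)) (z : R) :
    -z ∈ spectrum R a ↔ z ∈ spectrum R a := by
  let v : Aˣ := ⟨u, u, hu, hu⟩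
  have hconj : (v : A) * a * (v⁻¹ : Aˣ) = -a := by
    change u * a * u = -a
    rw [hua, neg_mul, mul_assoc, hu, mul_one]
  rw [← Set.mem_neg, spectrum.neg_eq, ← hconj, spectrum.units_conjugate]

/-- If `p` is a self-adjoint idempotent, then `2p - 1` anticommutes with `g + g*` whenever
`g = (1 - p) k p`. -/
theorem IsSelfAdjoint.anticommute_reflection {A : Type*} [Ring A] [StarRing A] {p k g : A}
    (hp : IsSelfAdjoint p) (hpp : p * p = p) (hg : g = (1 - p) * (k * p)) :
    (2 * p - 1) * (g + star g) = -((g + star g) * (2 * p - 1)) := by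
  have h₁ : p * g = 0 := by
    rw [hg, ← mul_assoc, mul_sub, mul_one, hpp, sub_self, zero_mul]
  have h₂ : g * p = g := by
    rw [hg, mul_assoc, mul_assoc, hpp]
  have h₃ : star g * p = 0 := by
    simpa [hp.star_eq] using congrArg star h₁
  have h₄ : p * star g = star g := by
    simpa [hp.star_eq] using congrArg star h₂
  simp only [two_mul, sub_mul, mul_sub, add_mul, mul_add, one_mul, mul_one, h₁, h₂, h₃, h₄]
  abel

/-- The spectrum of `H = G + G*` is symmetric with respect to zero. -/
theorem stmt2 {𝓗 : Type*} [NormedAddCommGroup 𝓗] [InnerProductSpace ℂ 𝓗]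
    [CompleteSpace 𝓗] (P K : 𝓗 →L[ℂ] 𝓗)
    (hP_sa : IsSelfAdjoint P) (hP_proj : P ∘L P = P)
    (G H : 𝓗 →L[ℂ] 𝓗)
    (hG : G = (1 - P) ∘L K ∘L P)
    (hH : H = G + ContinuousLinearMap.adjoint G) :
    ∀ z : ℂ, z ∈ spectrum ℂ H ↔ -z ∈ spectrum ℂ H := by
  intro z
  have hPP : P * P = P := hP_proj
  have hu : (2 * P - 1) * (2 * P - 1) = 1 := by
    simp only [two_mul, sub_mul, mul_sub, add_mul, mul_add, one_mul, mul_one, hPP]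
    abel
  subst hH
  exact (neg_mem_spectrum_iff_of_anticommute hu
    (hP_sa.anticommute_reflection hPP hG) z).symm
end

section
/- Let h : ℝ → ℝ be continuous and set f(t) = t·h(t). Then ∫₀^{1/2} f(t(1−t)) / (t(1−t)) dt = 2 ∫₀¹ f(s²/4) / (s √(1 − s²)) ds; both integrals converge absolutely. (This is the substitution s = 2√(t(1−t)) identifying the coefficient 𝔄(g; 1) = (2π)⁻² ∫₀¹ (g(t) − t g(1))/(t(1−t)) dt for g(t) = f evaluated along t − t² with one half of the coefficient 𝔘(f; 1) = (2/π²) ∫₀¹ f(t/2)/(t√(1−t²)) dt.) -/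
open MeasureTheory

lemma hasDerivAt_half_one_sub_sqrt {s : ℝ} (hs : s ∈ Set.Ioo (0 : ℝ) 1) :
    HasDerivAt (fun s : ℝ => (1 - Real.sqrt (1 - s ^ 2)) / 2)
      (s / (2 * Real.sqrt (1 - s ^ 2))) s := by
  have hpos : 0 < 1 - s ^ 2 := by nlinarith [hs.1, hs.2]
  have hsqrt : Real.sqrt (1 - s ^ 2) ≠ 0 := (Real.sqrt_pos.2 hpos).ne'
  have hinner : HasDerivAt (fun s : ℝ => 1 - s ^ 2) (-(2 * s)) s := by
    simpa using (hasDerivAt_pow 2 s).const_sub 1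
  refine (((hinner.sqrt hpos.ne').const_sub 1).div_const 2).congr_deriv ?_
  field_simp

lemma intervalIntegrable_div_two_mul_sqrt_one_sub_sq :
    IntervalIntegrable (fun s : ℝ => s / (2 * Real.sqrt (1 - s ^ 2))) volume 0 1 := by
  refine intervalIntegral.intervalIntegrable_deriv_of_nonneg
    (g := fun s : ℝ => (1 - Real.sqrt (1 - s ^ 2)) / 2) (by fun_prop) ?_ ?_
  · intro s hs
    exact hasDerivAt_half_one_sub_sqrt (by simpa using hs)
  · intro s hs
    have hs' : s ∈ Set.Ioo (0 : ℝ) 1 := by simpa using hs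
    have := hs'.1
    positivity

/-- For continuous `h` and `f t = t · h t`,
`∫₀^{1/2} f(t(1-t))/(t(1-t)) dt = 2 ∫₀¹ f(s²/4)/(s√(1-s²)) ds`,
and both integrals converge absolutely (i.e. are interval-integrable). -/
theorem stmt10 (h : ℝ → ℝ) (hcont : Continuous h) (f : ℝ → ℝ)
    (hf : ∀ t, f t = t * h t) :
    IntervalIntegrable (fun t => f (t * (1 - t)) / (t * (1 - t))) volume 0 (1/2) ∧
    IntervalIntegrable (fun s => f (s ^ 2 / 4) / (s * Real.sqrt (1 - s ^ 2))) volume 0 1 ∧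
    ∫ t in (0:ℝ)..(1/2), f (t * (1 - t)) / (t * (1 - t)) =
      2 * ∫ s in (0:ℝ)..1, f (s ^ 2 / 4) / (s * Real.sqrt (1 - s ^ 2)) := by
  have hleft : Set.EqOn (fun t => h (t * (1 - t)))
      (fun t => f (t * (1 - t)) / (t * (1 - t))) (Set.uIoc 0 (1 / 2)) := by
    intro t ht
    rw [Set.uIoc_of_le (by norm_num)] at ht
    have hne : t * (1 - t) ≠ 0 := (mul_pos ht.1 (by linarith [ht.2])).ne'
    simp only [hf, mul_div_cancel_left₀ _ hne]
  have hright : (fun s => f (s ^ 2 / 4) / (s * Real.sqrt (1 - s ^ 2))) =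
      fun s => (1 / 2) * (h (s ^ 2 / 4) * (s / (2 * Real.sqrt (1 - s ^ 2)))) := by
    funext s
    rw [hf]
    rcases eq_or_ne s 0 with rfl | hs
    · simp
    · rcases eq_or_ne (Real.sqrt (1 - s ^ 2)) 0 with h0 | h0
      · simp [h0]
      · field_simp
        ring
  have hweighted : IntervalIntegrable
      (fun s => h (s ^ 2 / 4) * (s / (2 * Real.sqrt (1 - s ^ 2)))) volume 0 1 :=
    intervalIntegrable_div_two_mul_sqrt_one_sub_sq.continuousOn_mul (by fun_prop)
  have hcomp : Set.EqOn
      (fun s => h (s ^ 2 / 4) * (s / (2 * Real.sqrt (1 - s ^ 2))))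
      (fun s => ((fun t => h (t * (1 - t))) ∘ fun s => (1 - Real.sqrt (1 - s ^ 2)) / 2) s *
        (s / (2 * Real.sqrt (1 - s ^ 2)))) (Set.uIcc 0 1) := by
    intro s hs
    rw [Set.uIcc_of_le zero_le_one] at hs
    have hsq := Real.sq_sqrt (show 0 ≤ 1 - s ^ 2 by nlinarith [hs.1, hs.2])
    simp only [Function.comp_apply]
    congr 2
    linarith
  refine ⟨(Continuous.intervalIntegrable (by fun_prop) 0 (1 / 2)).congr hleft, ?_, ?_⟩
  · rw [hright]
    exact hweighted.const_mul _
  · have hsubst := intervalIntegral.integral_comp_mul_deriv''' (a := 0) (b := 1)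
      (f := fun s : ℝ => (1 - Real.sqrt (1 - s ^ 2)) / 2)
      (f' := fun s => s / (2 * Real.sqrt (1 - s ^ 2)))
      (g := fun t => h (t * (1 - t))) (by fun_prop)
      (fun s hs => (hasDerivAt_half_one_sub_sqrt (by simpa using hs)).hasDerivWithinAt)
      (by fun_prop)
      ((Continuous.integrableOn_Icc (a := 0) (b := 1 / 2) (by fun_prop)).mono_set (by
        rintro _ ⟨s, hs, rfl⟩
        rw [Set.uIcc_of_le zero_le_one] at hs
        have hle : Real.sqrt (1 - s ^ 2) ≤ 1 := Real.sqrt_le_one.2 (by nlinarith [hs.1])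
        have hnn := Real.sqrt_nonneg (1 - s ^ 2)
        constructor <;> dsimp only <;> linarith))
      (by
        rw [← intervalIntegrable_iff']
        exact hweighted.congr (hcomp.mono Set.uIoc_subset_uIcc))
    rw [← intervalIntegral.integral_congr hcomp] at hsubst
    rw [hright, intervalIntegral.integral_const_mul, hsubst,
      ← intervalIntegral.integral_congr_ae (.of_forall fun _ ht => hleft ht)]
    norm_num
    ring
end

section
/- Hilbert's inequality with sharp constant for the Carleman kernel k(t) = 1/t: for every a ≥ 0, the truncated Hankel operator (Γ u)(x) = ∫_a^∞ u(y)/(x+y) dy on L²(a, ∞) has operator norm exactly π. Precisely: (i) for every measurable f : (a,∞) → [0,∞), ∫_a^∞ (∫_a^∞ f(y)/(x+y) dy)² dx ≤ π² ∫_a^∞ f(x)² dx; and (ii) π is optimal: for every C < π there exists a measurable f : (a,∞) → [0,∞) with 0 < ∫ـa^∞ f² < ∞ and ∫_a^∞ (∫_a^∞ f(y)/(x+y) dy)² dx > C² ∫_a^∞ f(x)² dx. -/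
open MeasureTheory ENNReal

open Filter Topology

theorem hasDerivAt_two_div_sqrt_mul_arctan {x y : ℝ} (hx : 0 < x) (hy : 0 < y) :
    HasDerivAt (fun y => 2 / √x * Real.arctan (√y / √x)) (1 / (√y * (x + y))) y := by
  have h := ((((hasDerivAt_id y).sqrt hy.ne').div_const (√x)).arctan).const_mul (2 / √x)
  refine h.congr_deriv ?_
  have hsx := Real.sqrt_pos.2 hx
  have hsy := Real.sqrt_pos.2 hy
  have h1 : (√y / √x) ^ 2 = y / x := by
    rw [div_pow, Real.sq_sqrt hx.le, Real.sq_sqrt hy.le]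
  rw [id, h1]
  field_simp
  rw [Real.sq_sqrt hx.le]

/-- The function `y ↦ y^{-1/2}` is an eigenfunction of the Carleman operator on `(0, ∞)`. -/
theorem lintegral_Ioi_one_div_sqrt_mul_add {x : ℝ} (hx : 0 < x) :
    ∫⁻ y in Set.Ioi 0, ENNReal.ofReal (1 / (√y * (x + y))) = ENNReal.ofReal (Real.pi / √x) := by
  have hcont : ContinuousWithinAt (fun y => 2 / √x * Real.arctan (√y / √x)) (Set.Ici 0) 0 := by
    refine Continuous.continuousWithinAt ?_
    exact continuous_const.mul (Real.continuous_arctan.comp (Real.continuous_sqrt.div_const _))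
  have hderiv : ∀ y ∈ Set.Ioi (0 : ℝ), HasDerivAt (fun y => 2 / √x * Real.arctan (√y / √x))
      (1 / (√y * (x + y))) y := fun y hy => hasDerivAt_two_div_sqrt_mul_arctan hx hy
  have hpos : ∀ y ∈ Set.Ioi (0 : ℝ), 0 ≤ 1 / (√y * (x + y)) := fun y hy => by
    have : (0 : ℝ) < y := hy
    positivity
  have hlim : Tendsto (fun y => 2 / √x * Real.arctan (√y / √x)) atTop
      (𝓝 (2 / √x * (Real.pi / 2))) := by
    refine Tendsto.const_mul _ ?_
    refine (Real.tendsto_arctan_atTop.mono_right nhdsWithin_le_nhds).comp ?_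
    exact Real.tendsto_sqrt_atTop.atTop_div_const (Real.sqrt_pos.2 hx)
  rw [← ofReal_integral_eq_lintegral_ofReal
    (integrableOn_Ioi_deriv_of_nonneg hcont hderiv hpos hlim)
    ((ae_restrict_iff' measurableSet_Ioi).2 (ae_of_all _ hpos)),
    integral_Ioi_of_hasDerivAt_of_nonneg hcont hderiv hpos hlim]
  congr 1
  simp

theorem lintegral_Ioc_ofReal_eq_sub_of_hasDerivAt {g g' : ℝ → ℝ} {p q : ℝ} (hpq : p ≤ q)
    (hderiv : ∀ y ∈ Set.Icc p q, HasDerivAt g (g' y) y) (hcont : ContinuousOn g' (Set.Icc p q))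
    (hpos : ∀ y ∈ Set.Icc p q, 0 ≤ g' y) :
    ∫⁻ y in Set.Ioc p q, ENNReal.ofReal (g' y) = ENNReal.ofReal (g q - g p) := by
  have hint : IntervalIntegrable g' volume p q := by
    refine ContinuousOn.intervalIntegrable ?_
    rwa [Set.uIcc_of_le hpq]
  rw [← intervalIntegral.integral_eq_sub_of_hasDerivAt
      (by rwa [Set.uIcc_of_le hpq]) hint,
    intervalIntegral.integral_of_le hpq,
    ofReal_integral_eq_lintegral_ofReal
      ((intervalIntegrable_iff_integrableOn_Ioc_of_le hpq).1 hint)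
      ((ae_restrict_iff' measurableSet_Ioc).2
        (ae_of_all _ fun y hy => hpos y (Set.Ioc_subset_Icc_self hy)))]

theorem lintegral_Ioc_one_div_sqrt_mul_add {x p q : ℝ} (hx : 0 < x) (hp : 0 < p) (hpq : p ≤ q) :
    ∫⁻ y in Set.Ioc p q, ENNReal.ofReal (1 / (√y * (x + y))) =
      ENNReal.ofReal (2 / √x * Real.arctan (√q / √x) - 2 / √x * Real.arctan (√p / √x)) := by
  have hp' : ∀ y ∈ Set.Icc p q, 0 < √y * (x + y) := fun y hy => by
    have : 0 < y := hp.trans_le hy.1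
    positivity
  refine lintegral_Ioc_ofReal_eq_sub_of_hasDerivAt
    (g := fun y => 2 / √x * Real.arctan (√y / √x)) hpq
    (fun y hy => hasDerivAt_two_div_sqrt_mul_arctan hx (hp.trans_le hy.1)) ?_
    fun y hy => (one_div_pos.2 (hp' y hy)).le
  exact continuousOn_const.div (by fun_prop) fun y hy => (hp' y hy).ne'

theorem lintegral_Ioc_const_div {c p q : ℝ} (hc : 0 ≤ c) (hp : 0 < p) (hpq : p ≤ q) :
    ∫⁻ x in Set.Ioc p q, ENNReal.ofReal (c / x) = ENNReal.ofReal (c * Real.log (q / p)) := by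
  have hp' : ∀ y ∈ Set.Icc p q, 0 < y := fun y hy => hp.trans_le hy.1
  rw [Real.log_div (hp.trans_le hpq).ne' hp.ne', mul_sub]
  refine lintegral_Ioc_ofReal_eq_sub_of_hasDerivAt (g := fun y => c * Real.log y) hpq
    (fun y hy => ?_) (continuousOn_const.div continuousOn_id fun y hy => (hp' y hy).ne')
    fun y hy => div_nonneg hc (hp' y hy).le
  simpa [div_eq_mul_inv] using (Real.hasDerivAt_log (hp' y hy).ne').const_mul c

/-- The Cauchy-Schwarz inequality for lower Lebesgue integrals. -/
theorem sq_lintegral_mul_le {α : Type*} [MeasurableSpace α] (μ : Measure α) {u v : α → ℝ≥0∞}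
    (hu : Measurable u) (hv : Measurable v) :
    (∫⁻ x, u x * v x ∂μ) ^ 2 ≤ (∫⁻ x, u x ^ 2 ∂μ) * ∫⁻ x, v x ^ 2 ∂μ := by
  have h := ENNReal.lintegral_mul_le_Lp_mul_Lq μ Real.HolderConjugate.two_two
    hu.aemeasurable hv.aemeasurable
  have hs : ∀ z : ℝ≥0∞, (z ^ (1 / 2 : ℝ)) ^ 2 = z := fun z => by
    rw [← ENNReal.rpow_natCast, ← ENNReal.rpow_mul]; norm_num
  simp only [Pi.mul_apply, ENNReal.rpow_two] at h
  calc _ ≤ _ := pow_le_pow_left' h 2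
    _ = _ := by rw [mul_pow, hs, hs]

/-- The Schur test for the Carleman kernel with weight `y^{-1/2}`: the pointwise estimate. -/
theorem sq_lintegral_div_add_le {a x : ℝ} (ha : 0 ≤ a) (hx : 0 < x) {f : ℝ → ℝ≥0∞}
    (hf : Measurable f) :
    (∫⁻ y in Set.Ioi a, f y / ENNReal.ofReal (x + y)) ^ 2 ≤
      ∫⁻ y in Set.Ioi a, ENNReal.ofReal Real.pi * (f y ^ 2 * ENNReal.ofReal (√y) *
        ENNReal.ofReal (1 / (√x * (y + x)))) := by
  have key := sq_lintegral_mul_le (volume.restrict (Set.Ioi a))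
    (u := fun y => f y * ENNReal.ofReal √(√y / (x + y)))
    (v := fun y => ENNReal.ofReal √(1 / (√y * (x + y))))
    (by fun_prop) (by fun_prop)
  have hv : ∫⁻ y in Set.Ioi a, ENNReal.ofReal √(1 / (√y * (x + y))) ^ 2 ≤
      ENNReal.ofReal (Real.pi / √x) := by
    rw [← lintegral_Ioi_one_div_sqrt_mul_add hx]
    refine (lintegral_mono_set (Set.Ioi_subset_Ioi ha)).trans_eq ?_
    refine setLIntegral_congr_fun measurableSet_Ioi fun y (hy : 0 < y) => ?_
    rw [← ENNReal.ofReal_pow (Real.sqrt_nonneg _), Real.sq_sqrt (by positivity)]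
  calc _ = (∫⁻ y in Set.Ioi a, (f y * ENNReal.ofReal √(√y / (x + y))) *
        ENNReal.ofReal √(1 / (√y * (x + y)))) ^ 2 := by
        congr 1
        refine setLIntegral_congr_fun measurableSet_Ioi fun y (hy : a < y) => ?_
        have hy0 : 0 < y := ha.trans_lt hy
        have hsy := Real.sqrt_pos.2 hy0
        rw [mul_assoc, ← ENNReal.ofReal_mul (Real.sqrt_nonneg _),
          ← Real.sqrt_mul (by positivity), div_eq_mul_inv,
          ← ENNReal.ofReal_inv_of_pos (by positivity)]
        congr 2
        rw [show √y / (x + y) * (1 / (√y * (x + y))) = ((x + y)⁻¹) ^ 2 by field_simp,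
          Real.sqrt_sq (by positivity)]
    _ ≤ _ := key
    _ ≤ (∫⁻ y in Set.Ioi a, (f y * ENNReal.ofReal √(√y / (x + y))) ^ 2) *
        ENNReal.ofReal (Real.pi / √x) := by gcongr
    _ = _ := by
        rw [← lintegral_mul_const _ (by fun_prop)]
        refine setLIntegral_congr_fun measurableSet_Ioi fun y (hy : a < y) => ?_
        have hy0 : 0 < y := ha.trans_lt hy
        have hsx := Real.sqrt_pos.2 hx
        rw [mul_pow, ← ENNReal.ofReal_pow (Real.sqrt_nonneg _), Real.sq_sqrt (by positivity),
          mul_assoc, mul_assoc, mul_left_comm (ENNReal.ofReal Real.pi),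
          ← ENNReal.ofReal_mul (by positivity), ← ENNReal.ofReal_mul (by positivity),
          ← ENNReal.ofReal_mul (by positivity)]
        congr 2
        field_simp
        ring

theorem lintegral_sq_lintegral_div_add_le {a : ℝ} (ha : 0 ≤ a) {f : ℝ → ℝ≥0∞}
    (hf : Measurable f) :
    (∫⁻ x in Set.Ioi a, (∫⁻ y in Set.Ioi a, f y / ENNReal.ofReal (x + y)) ^ 2) ≤
      ENNReal.ofReal (Real.pi ^ 2) * ∫⁻ x in Set.Ioi a, (f x) ^ 2 := by
  calc _ ≤ ∫⁻ x in Set.Ioi a, ∫⁻ y in Set.Ioi a, ENNReal.ofReal Real.pi *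
        (f y ^ 2 * ENNReal.ofReal (√y) * ENNReal.ofReal (1 / (√x * (y + x)))) :=
        setLIntegral_mono' measurableSet_Ioi fun x (hx : a < x) =>
          sq_lintegral_div_add_le ha (ha.trans_lt hx) hf
    _ = ∫⁻ y in Set.Ioi a, ∫⁻ x in Set.Ioi a, ENNReal.ofReal Real.pi *
        (f y ^ 2 * ENNReal.ofReal (√y) * ENNReal.ofReal (1 / (√x * (y + x)))) :=
        lintegral_lintegral_swap (by unfold Function.uncurry; fun_prop)
    _ ≤ ∫⁻ y in Set.Ioi a, ENNReal.ofReal (Real.pi ^ 2) * f y ^ 2 := by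
        refine setLIntegral_mono' measurableSet_Ioi fun y (hy : a < y) => ?_
        have hy0 : 0 < y := ha.trans_lt hy
        have hsy := Real.sqrt_pos.2 hy0
        rw [lintegral_const_mul _ (by fun_prop), lintegral_const_mul _ (by fun_prop)]
        calc _ ≤ ENNReal.ofReal Real.pi * (f y ^ 2 * ENNReal.ofReal (√y) *
              ENNReal.ofReal (Real.pi / √y)) := by
              gcongr
              rw [← lintegral_Ioi_one_div_sqrt_mul_add hy0]
              exact lintegral_mono_set (Set.Ioi_subset_Ioi ha)
          _ = _ := by
              rw [mul_assoc, mul_left_comm, ← ENNReal.ofReal_mul (by positivity),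
                ← ENNReal.ofReal_mul (by positivity), mul_comm]
              congr 2
              field_simp
    _ = _ := lintegral_const_mul _ (by fun_prop)

/-- The constant for which `y ↦ y^{-1/2}`, truncated to an interval, is a pointwise
approximate eigenfunction at multiplicative distance `m ^ 2` from the end points. -/
theorem ofReal_div_sqrt_le_lintegral_Ioc {p q x m : ℝ} (hp : 0 < p) (hpq : p ≤ q) (hm : 0 < m)
    (hpx : p * m ^ 2 ≤ x) (hxq : x * m ^ 2 ≤ q) :
    ENNReal.ofReal (2 * (Real.arctan m - Real.arctan m⁻¹) / √x) ≤
      ∫⁻ y in Set.Ioc p q, ENNReal.ofReal (1 / (√y * (x + y))) := by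
  have hx : 0 < x := lt_of_lt_of_le (by positivity) hpx
  have hsx := Real.sqrt_pos.2 hx
  rw [lintegral_Ioc_one_div_sqrt_mul_add hx hp hpq]
  refine ENNReal.ofReal_le_ofReal ?_
  have h1 : Real.arctan m ≤ Real.arctan (√q / √x) := by
    refine Real.arctan_mono ?_
    rw [le_div_iff₀ hsx]
    refine Real.le_sqrt_of_sq_le ?_
    rw [mul_pow, Real.sq_sqrt hx.le]
    linarith
  have h2 : Real.arctan (√p / √x) ≤ Real.arctan m⁻¹ := by
    refine Real.arctan_mono ?_
    rw [div_le_iff₀ hsx, inv_mul_eq_div, le_div_iff₀ hm]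
    refine Real.le_sqrt_of_sq_le ?_
    rwa [mul_pow, Real.sq_sqrt hp.le]
  calc _ = 2 / √x * (Real.arctan m - Real.arctan m⁻¹) := by ring
    _ ≤ 2 / √x * (Real.arctan (√q / √x) - Real.arctan (√p / √x)) := by gcongr
    _ = _ := by ring

theorem exists_lt_two_mul_arctan_sub_arctan_inv {C : ℝ} (hC : C < Real.pi) :
    ∃ m : ℝ, 1 < m ∧ C < 2 * (Real.arctan m - Real.arctan m⁻¹) := by
  have h : Tendsto (fun m : ℝ => 2 * (Real.arctan m - Real.arctan m⁻¹)) atTop (𝓝 Real.pi) := by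
    have h1 := Real.tendsto_arctan_atTop.mono_right nhdsWithin_le_nhds
    have h2 := (Real.continuous_arctan.tendsto 0).comp tendsto_inv_atTop_zero
    have h3 := (h1.sub h2).const_mul 2
    rwa [Real.arctan_zero, sub_zero, mul_div_cancel₀ _ two_ne_zero] at h3
  exact ((eventually_gt_atTop 1).and (h.eventually_const_lt hC)).exists

theorem exists_lintegral_sq_lintegral_div_add_gt {a C : ℝ} (ha : 0 ≤ a) (hC0 : 0 ≤ C)
    (hC : C < Real.pi) :
    ∃ f : ℝ → ℝ≥0∞, Measurable f ∧
      0 < (∫⁻ x in Set.Ioi a, (f x) ^ 2) ∧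
      (∫⁻ x in Set.Ioi a, (f x) ^ 2) < ⊤ ∧
      ENNReal.ofReal (C ^ 2) * (∫⁻ x in Set.Ioi a, (f x) ^ 2) <
        ∫⁻ x in Set.Ioi a,
          (∫⁻ y in Set.Ioi a, f y / ENNReal.ofReal (x + y)) ^ 2 := by
  obtain ⟨m, hm, hCc⟩ := exists_lt_two_mul_arctan_sub_arctan_inv hC
  set c := 2 * (Real.arctan m - Real.arctan m⁻¹)
  have hc : 0 < c := hC0.trans_lt hCc
  have hm0 : 0 < m := one_pos.trans hm
  obtain ⟨L, hL0, hL⟩ : ∃ L : ℝ, 0 < L ∧ C ^ 2 * L < c ^ 2 * (L - 4 * Real.log m) := by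
    have hd : 0 < c ^ 2 - C ^ 2 := sub_pos.2 (pow_lt_pow_left₀ hCc hC0 two_ne_zero)
    have h := tendsto_id.const_mul_atTop hd
    obtain ⟨L, h1, h2⟩ := ((eventually_gt_atTop 0).and
      (h.eventually_gt_atTop (c ^ 2 * (4 * Real.log m)))).exists
    exact ⟨L, h1, by simp only [id] at h2; linarith⟩
  have hLm : 0 < L - 4 * Real.log m :=
    pos_of_mul_pos_right ((by positivity : 0 ≤ C ^ 2 * L).trans_lt hL) (by positivity)
  have hp : 0 < a + 1 := by linarith
  set p := a + 1 with hp_def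
  set q := p * Real.exp L with hq_def
  have hpq : p ≤ q := le_mul_of_one_le_right hp.le (Real.one_le_exp hL0.le)
  have hexp : m ^ 4 ≤ Real.exp L := by
    rw [← Real.log_le_iff_le_exp (by positivity), Real.log_pow]
    push_cast
    linarith
  have hpq' : p * m ^ 2 ≤ q / m ^ 2 := by
    rw [le_div_iff₀ (by positivity), mul_assoc, ← pow_add]
    exact mul_le_mul_of_nonneg_left hexp hp.le
  have hsub : Set.Ioc p q ⊆ Set.Ioi a := fun y hy => by
    have := hy.1
    simp only [Set.mem_Ioi]
    linarith
  set f : ℝ → ℝ≥0∞ := (Set.Ioc p q).indicator fun y => ENNReal.ofReal (1 / √y) with hf_def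
  have hnorm : ∫⁻ x in Set.Ioi a, f x ^ 2 = ENNReal.ofReal L := by
    have h1 : (fun x => f x ^ 2) = (Set.Ioc p q).indicator fun y => ENNReal.ofReal (1 / y) := by
      ext x
      by_cases hx : x ∈ Set.Ioc p q
      · have hx0 : 0 < x := hp.trans hx.1
        simp only [hf_def, Set.indicator_of_mem hx]
        rw [← ENNReal.ofReal_pow (by positivity), div_pow, Real.sq_sqrt hx0.le, one_pow]
      · simp [hf_def, Set.indicator_of_notMem hx]
    rw [h1, setLIntegral_indicator measurableSet_Ioc, Set.inter_eq_left.2 hsub,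
      lintegral_Ioc_const_div zero_le_one hp hpq, hq_def, mul_div_cancel_left₀ _ hp.ne',
      Real.log_exp, one_mul]
  refine ⟨f, Measurable.indicator (by fun_prop) measurableSet_Ioc, ?_, ?_, ?_⟩
  · rw [hnorm]
    exact ENNReal.ofReal_pos.2 hL0
  · rw [hnorm]
    exact ENNReal.ofReal_lt_top
  · rw [hnorm, ← ENNReal.ofReal_mul (by positivity)]
    calc _ < ENNReal.ofReal (c ^ 2 * (L - 4 * Real.log m)) :=
          (ENNReal.ofReal_lt_ofReal_iff (by positivity)).2 hL
      _ = ∫⁻ x in Set.Ioc (p * m ^ 2) (q / m ^ 2), ENNReal.ofReal (c ^ 2 / x) := by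
          rw [lintegral_Ioc_const_div (by positivity) (by positivity) hpq',
            show q / m ^ 2 / (p * m ^ 2) = Real.exp L / m ^ 4 by rw [hq_def]; field_simp,
            Real.log_div (by positivity) (by positivity), Real.log_exp, Real.log_pow]
          push_cast
          rfl
      _ ≤ ∫⁻ x in Set.Ioc (p * m ^ 2) (q / m ^ 2),
            (∫⁻ y in Set.Ioi a, f y / ENNReal.ofReal (x + y)) ^ 2 := by
          refine setLIntegral_mono' measurableSet_Ioc fun x hx => ?_
          have hx0 : 0 < x := lt_trans (by positivity) hx.1
          have h1 : c ^ 2 / x = (c / √x) ^ 2 := by rw [div_pow, Real.sq_sqrt hx0.le]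
          rw [h1, ENNReal.ofReal_pow (by positivity)]
          refine pow_le_pow_left' ?_ 2
          calc _ ≤ _ := ofReal_div_sqrt_le_lintegral_Ioc hp hpq hm0 hx.1.le
                ((le_div_iff₀ (by positivity)).1 hx.2)
            _ = ∫⁻ y in Set.Ioc p q, f y / ENNReal.ofReal (x + y) := by
                refine setLIntegral_congr_fun measurableSet_Ioc fun y hy => ?_
                have hy0 : 0 < y := hp.trans hy.1
                simp only [hf_def, Set.indicator_of_mem hy]
                rw [← ENNReal.ofReal_div_of_pos (by positivity), div_div]
            _ ≤ _ := lintegral_mono_set hsub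
      _ ≤ _ := by
          refine lintegral_mono_set fun x hx => ?_
          have h1 : p * 1 ≤ p * m ^ 2 :=
            mul_le_mul_of_nonneg_left (one_le_pow₀ hm.le) hp.le
          have := hx.1
          simp only [Set.mem_Ioi]
          linarith

/-- Hilbert's inequality with sharp constant `π` for the Carleman kernel
`k(t) = 1/t` on `L²(a,∞)`, `a ≥ 0`: (i) for every measurable `f ≥ 0`,
`∫_a^∞ (∫_a^∞ f(y)/(x+y) dy)² dx ≤ π² ∫_a^∞ f²`; (ii) the constant `π` is optimal. -/
theorem stmt13 (a : ℝ) (ha : 0 ≤ a) :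
    (∀ f : ℝ → ℝ≥0∞, Measurable f →
      (∫⁻ x in Set.Ioi a,
          (∫⁻ y in Set.Ioi a, f y / ENNReal.ofReal (x + y)) ^ 2) ≤
        ENNReal.ofReal (Real.pi ^ 2) * ∫⁻ x in Set.Ioi a, (f x) ^ 2) ∧
    (∀ C : ℝ, 0 ≤ C → C < Real.pi →
      ∃ f : ℝ → ℝ≥0∞, Measurable f ∧
        0 < (∫⁻ x in Set.Ioi a, (f x) ^ 2) ∧
        (∫⁻ x in Set.Ioi a, (f x) ^ 2) < ⊤ ∧
        ENNReal.ofReal (C ^ 2) * (∫⁻ x in Set.Ioi a, (f x) ^ 2) <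
          ∫⁻ x in Set.Ioi a,
            (∫⁻ y in Set.Ioi a, f y / ENNReal.ofReal (x + y)) ^ 2) := by
  exact ⟨fun f hf => lintegral_sq_lintegral_div_add_le ha hf,
    fun C hC0 hC => exists_lintegral_sq_lintegral_div_add_gt ha hC0 hC⟩
end
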